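/- Let n ≥ 5 and 3 ≤ K ≤ n−2, and let a ∈ {1,2}. The inequality x_{1,2} + x_{a,3} − Σ_{i=4}^{n} x_i ≤ 3 − K (which expresses x_{a,3} + x_3 ≤ 1 in the variables of P_{n,K}) is facet-defining for P_{n,K}. -/

import Mathlib

/-- A `K`-partition of `V = {1,…,n}`: a family of `K` nonempty pairwise disjoint
subsets of `V` (clusters) whose union is `V`. -/
structure KPartition (n K : ℕ) where
  parts : Finset (Finset ℕ)
  card_parts : parts.card = K
  parts_nonempty : ∀ C ∈ parts, C.Nonempty
  parts_disjoint : ∀ C ∈ parts, ∀ D ∈ parts, C ≠ D → Disjoint C D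
  parts_cover : parts.sup id = Finset.Icc 1 n

/-- The ambient space: one (symmetric) edge coordinate for each pair of vertices and one
representative coordinate for each vertex (only the coordinates of edges `uv ∈ E` and of
vertices `v ∈ {4,…,n}` are actually used; the remaining ones are affinely determined, so
affine dimensions agree with those in `ℝ^{|E|+n-3}`). -/
abbrev GPoint : Type := (ℕ × ℕ → ℝ) × (ℕ → ℝ)

open Classical in
/-- The characteristic vector of a `K`-partition: edge component `x_{u,v} = 1` iff `u` and `v`
lie in the same cluster; representative component `x_v = 1` (for `v ∈ {4,…,n}`) iff `v` is the
smallest element of its cluster. -/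
noncomputable def charVec (n K : ℕ) (π : KPartition n K) : GPoint :=
  ⟨fun p => if ∃ C ∈ π.parts, p.1 ∈ C ∧ p.2 ∈ C then 1 else 0,
   fun v => if 4 ≤ v ∧ ∃ C ∈ π.parts, v ∈ C ∧ ∀ w ∈ C, v ≤ w then 1 else 0⟩

/-- `P_{n,K}`: the convex hull of the characteristic vectors of all `K`-partitions. -/
noncomputable def PolyP (n K : ℕ) : Set GPoint :=
  convexHull ℝ {x | ∃ π : KPartition n K, x = charVec n K π}

/-- Affine dimension of a set: the rank of the direction of its affine span. -/
noncomputable def adim (s : Set GPoint) : ℕ :=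
  Module.finrank ℝ (affineSpan ℝ s).direction

/-- `f x ≤ b` is a valid inequality for `P_{n,K}` which is facet-defining. -/
def IsFacetLe (n K : ℕ) (f : GPoint → ℝ) (b : ℝ) : Prop :=
  (∀ x ∈ PolyP n K, f x ≤ b) ∧
  adim {x | x ∈ PolyP n K ∧ f x = b} + 1 = adim (PolyP n K)

/-- `f x ≥ b` is a valid inequality for `P_{n,K}` which is facet-defining. -/
def IsFacetGe (n K : ℕ) (f : GPoint → ℝ) (b : ℝ) : Prop :=
  (∀ x ∈ PolyP n K, b ≤ f x) ∧
  adim {x | x ∈ PolyP n K ∧ f x = b} + 1 = adim (PolyP n K)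

/-- Sum of the edge components of `x` over the edges with both endpoints in `A`. -/
noncomputable def edgeSum (A : Finset ℕ) (x : GPoint) : ℝ :=
  ∑ e ∈ A.offDiag.filter (fun e => e.1 < e.2), x.1 e

/-- `v` is the smallest vertex of its colour class. -/
def IsRep (n : ℕ) (c : ℕ → ℕ) (v : ℕ) : Prop :=
  ∀ w ∈ Finset.Icc 1 n, c w = c v → v ≤ w

open Classical Finset in
/-- The characteristic vector of the partition of `{1,…,n}` into the colour classes of `c`. -/
noncomputable def colorVec (n : ℕ) (c : ℕ → ℕ) : GPoint :=
  ⟨fun p => if p.1 ∈ Icc 1 n ∧ p.2 ∈ Icc 1 n ∧ c p.1 = c p.2 then 1 else 0,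
   fun v => if 4 ≤ v ∧ v ∈ Icc 1 n ∧ IsRep n c v then 1 else 0⟩

/-- `c` uses exactly `K` colours on `{1,…,n}`. -/
def IsKColoring (n K : ℕ) (c : ℕ → ℕ) : Prop :=
  ((Finset.Icc 1 n).image c).card = K

lemma exists_partition_of_coloring {n K : ℕ} {c : ℕ → ℕ} (hc : IsKColoring n K c) :
    ∃ π : KPartition n K, charVec n K π = colorVec n c := by
  classical
  let cls : ℕ → Finset ℕ := fun k => (Finset.Icc 1 n).filter (fun v => c v = k)
  have hmem : ∀ k v, v ∈ cls k ↔ v ∈ Finset.Icc 1 n ∧ c v = k := fun k v => by simp [cls]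
  let P := ((Finset.Icc 1 n).image c).image cls
  have hP : ∀ C, C ∈ P ↔ ∃ v ∈ Finset.Icc 1 n, cls (c v) = C := fun C => by
    simp [P, Finset.mem_image]
  have hcov : P.sup id = Finset.Icc 1 n := by
    ext v
    simp only [Finset.mem_sup, hP, id]
    constructor
    · rintro ⟨_, ⟨w, hw, rfl⟩, hv⟩
      exact ((hmem _ _).1 hv).1
    · exact fun hv => ⟨_, ⟨v, hv, rfl⟩, (hmem _ _).2 ⟨hv, rfl⟩⟩
  refine ⟨⟨P, ?_, ?_, ?_, hcov⟩, ?_⟩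
  · rw [Finset.card_image_of_injOn, hc]
    intro k hk l _ hkl
    obtain ⟨v, hv, rfl⟩ := Finset.mem_image.1 (Finset.mem_coe.1 hk)
    have : v ∈ cls l := hkl ▸ (hmem _ _).2 ⟨hv, rfl⟩
    exact ((hmem _ _).1 this).2
  · intro C hC
    obtain ⟨v, hv, rfl⟩ := (hP C).1 hC
    exact ⟨v, (hmem _ _).2 ⟨hv, rfl⟩⟩
  · intro C hC D hD hne
    obtain ⟨v, hv, rfl⟩ := (hP C).1 hC
    obtain ⟨w, hw, rfl⟩ := (hP D).1 hD
    rw [Finset.disjoint_left]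
    intro x hx hy
    rw [hmem] at hx hy
    exact hne (by rw [← hx.2, hy.2])
  · refine Prod.ext (funext fun p => ?_) (funext fun v => ?_)
    · simp only [charVec, colorVec]
      refine if_congr ?_ rfl rfl
      constructor
      · rintro ⟨C, hC, h1, h2⟩
        obtain ⟨v, hv, rfl⟩ := (hP C).1 hC
        rw [hmem] at h1 h2
        exact ⟨h1.1, h2.1, h1.2.trans h2.2.symm⟩
      · rintro ⟨h1, h2, h3⟩
        exact ⟨_, (hP _).2 ⟨p.1, h1, rfl⟩, (hmem _ _).2 ⟨h1, rfl⟩, (hmem _ _).2 ⟨h2, h3.symm⟩⟩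
    · simp only [charVec, colorVec]
      refine if_congr (and_congr_right fun _ => ?_) rfl rfl
      constructor
      · rintro ⟨C, hC, h1, h2⟩
        obtain ⟨u, hu, rfl⟩ := (hP C).1 hC
        rw [hmem] at h1
        exact ⟨h1.1, fun w hw h => h2 w ((hmem _ _).2 ⟨hw, h.trans h1.2⟩)⟩
      · rintro ⟨h1, h2⟩
        exact ⟨_, (hP _).2 ⟨v, h1, rfl⟩, (hmem _ _).2 ⟨h1, rfl⟩, fun w hw =>
          h2 w ((hmem _ _).1 hw).1 ((hmem _ _).1 hw).2⟩

lemma exists_coloring_of_partition {n K : ℕ} (π : KPartition n K) :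
    ∃ c, IsKColoring n K c ∧ charVec n K π = colorVec n c := by
  classical
  have hmem : ∀ v, v ∈ Finset.Icc 1 n ↔ ∃ C ∈ π.parts, v ∈ C := fun v => by
    rw [← π.parts_cover, Finset.mem_sup]; rfl
  have huniq : ∀ C ∈ π.parts, ∀ D ∈ π.parts, ∀ v, v ∈ C → v ∈ D → C = D := by
    intro C hC D hD v hv hw
    by_contra hne
    exact Finset.disjoint_left.1 (π.parts_disjoint C hC D hD hne) hv hw
  have hex : ∀ v, ∃ C, v ∈ Finset.Icc 1 n → C ∈ π.parts ∧ v ∈ C := by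
    intro v
    by_cases hv : v ∈ Finset.Icc 1 n
    · obtain ⟨C, h⟩ := (hmem v).1 hv
      exact ⟨C, fun _ => h⟩
    · exact ⟨∅, fun h => absurd h hv⟩
  choose cl hcl using hex
  have hcl_eq : ∀ C ∈ π.parts, ∀ v ∈ C, cl v = C := fun C hC v hv =>
    have h := hcl v ((hmem v).2 ⟨C, hC, hv⟩)
    huniq _ h.1 C hC v h.2 hv
  have henc : ∀ v w, Encodable.encode (cl v) = Encodable.encode (cl w) ↔ cl v = cl w :=
    fun v w => Encodable.encode_inj
  refine ⟨fun v => Encodable.encode (cl v), ?_, ?_⟩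
  · have himg : (Finset.Icc 1 n).image (fun v => Encodable.encode (cl v)) =
        π.parts.image Encodable.encode := by
      ext k
      simp only [Finset.mem_image]
      constructor
      · rintro ⟨v, hv, rfl⟩
        exact ⟨_, (hcl v hv).1, rfl⟩
      · rintro ⟨C, hC, rfl⟩
        obtain ⟨v, hv⟩ := π.parts_nonempty C hC
        exact ⟨v, (hmem v).2 ⟨C, hC, hv⟩, by rw [hcl_eq C hC v hv]⟩
    rw [IsKColoring, himg, Finset.card_image_of_injective _ Encodable.encode_injective,
      π.card_parts]
  · refine Prod.ext (funext fun p => ?_) (funext fun v => ?_)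
    · simp only [charVec, colorVec, henc]
      refine if_congr ?_ rfl rfl
      constructor
      · rintro ⟨C, hC, h1, h2⟩
        exact ⟨(hmem _).2 ⟨C, hC, h1⟩, (hmem _).2 ⟨C, hC, h2⟩,
          (hcl_eq C hC _ h1).trans (hcl_eq C hC _ h2).symm⟩
      · rintro ⟨h1, h2, h3⟩
        exact ⟨_, (hcl _ h1).1, (hcl _ h1).2, h3 ▸ (hcl _ h2).2⟩
    · simp only [charVec, colorVec, IsRep, henc]
      refine if_congr (and_congr_right fun _ => ?_) rfl rfl
      constructor
      · rintro ⟨C, hC, h1, h2⟩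
        have hv := (hmem _).2 ⟨C, hC, h1⟩
        refine ⟨hv, fun w hw h => h2 w ?_⟩
        rw [← hcl_eq C hC v h1, ← h]
        exact (hcl w hw).2
      · rintro ⟨h1, h2⟩
        refine ⟨_, (hcl v h1).1, (hcl v h1).2, fun w hw => ?_⟩
        exact h2 w ((hmem _).2 ⟨_, (hcl v h1).1, hw⟩) (hcl_eq _ (hcl v h1).1 w hw)

lemma setOf_charVec_eq (n K : ℕ) :
    {x | ∃ π : KPartition n K, x = charVec n K π} = colorVec n '' {c | IsKColoring n K c} := by
  ext x
  constructor
  · rintro ⟨π, rfl⟩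
    obtain ⟨c, hc, h⟩ := exists_coloring_of_partition π
    exact ⟨c, hc, h.symm⟩
  · rintro ⟨c, hc, rfl⟩
    obtain ⟨π, h⟩ := exists_partition_of_coloring hc
    exact ⟨π, h.symm⟩

lemma finite_setOf_charVec (n K : ℕ) : {x | ∃ π : KPartition n K, x = charVec n K π}.Finite := by
  classical
  have : Finite (KPartition n K) := by
    refine Finite.of_injective
      (β := ((Finset.Icc 1 n).powerset.powerset : Finset (Finset (Finset ℕ))))
      (fun π => ⟨π.parts, ?_⟩) ?_
    · rw [Finset.mem_powerset]
      intro C hC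
      rw [Finset.mem_powerset, ← π.parts_cover]
      exact Finset.le_sup (f := id) hC
    · rintro ⟨P, _, _, _, _⟩ ⟨Q, _, _, _, _⟩ h
      simpa using h
  refine (Set.finite_range (charVec n K)).subset ?_
  rintro x ⟨π, rfl⟩
  exact ⟨π, rfl⟩

lemma IsKColoring.update {n K : ℕ} {c : ℕ → ℕ} (hc : IsKColoring n K c) {u k v w : ℕ}
    (hv : v ∈ Finset.Icc 1 n) (hvu : v ≠ u) (hcv : c v = c u)
    (hw : w ∈ Finset.Icc 1 n) (hwu : w ≠ u) (hcw : c w = k) :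
    IsKColoring n K (Function.update c u k) := by
  have : (Finset.Icc 1 n).image (Function.update c u k) = (Finset.Icc 1 n).image c := by
    ext j
    simp only [Finset.mem_image]
    constructor
    · rintro ⟨x, hx, rfl⟩
      by_cases hxu : x = u
      · subst hxu
        exact ⟨w, hw, by simp [hcw]⟩
      · exact ⟨x, hx, by simp [hxu]⟩
    · rintro ⟨x, hx, rfl⟩
      by_cases hxu : x = u
      · subst hxu
        exact ⟨v, hv, by simp [hvu, hcv]⟩
      · exact ⟨x, hx, by simp [hxu]⟩
  rw [IsKColoring, this, hc]

/-- The (symmetric) unit vector of the edge `uv`. -/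
def edgeVec (u v : ℕ) : GPoint :=
  ⟨Pi.single (u, v) 1 + Pi.single (v, u) 1, 0⟩

lemma edgeVec_comm (u v : ℕ) : edgeVec u v = edgeVec v u := by
  simp [edgeVec, add_comm]

/-- Recolouring a vertex that is smallest in neither its old nor its new class changes only
edge coordinates at that vertex. -/
lemma colorVec_update {n : ℕ} {c : ℕ → ℕ} {u k v w : ℕ} (hu : u ∈ Finset.Icc 1 n)
    (hv : v ∈ Finset.Icc 1 n) (hvu : v < u) (hcv : c v = c u)
    (hw : w ∈ Finset.Icc 1 n) (hwu : w < u) (hcw : c w = k) :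
    colorVec n (Function.update c u k) = colorVec n c + ∑ x ∈ (Finset.Icc 1 n).erase u,
      ((if c x = k then (1 : ℝ) else 0) - (if c x = c u then 1 else 0)) • edgeVec u x := by
  classical
  refine Prod.ext (funext fun p => ?_) (funext fun y => ?_)
  · obtain ⟨p, q⟩ := p
    rw [Prod.fst_add, Prod.fst_sum, Pi.add_apply, Finset.sum_apply]
    simp only [Prod.smul_fst, Pi.smul_apply, edgeVec, Pi.add_apply, smul_eq_mul]
    by_cases hp : p = u
    · by_cases hq : q = u
      · subst hp; subst hq
        rw [Finset.sum_eq_zero]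
        · simp [colorVec]
        · intro x hx
          have := Finset.ne_of_mem_erase hx
          simp [this.symm]
      · subst hp
        by_cases hqI : q ∈ Finset.Icc 1 n
        · rw [Finset.sum_eq_single q]
          · simp only [colorVec, Function.update_self, Function.update_of_ne hq, hu, hqI,
              true_and, Pi.single_apply, Prod.mk.injEq, hq, and_false, if_true,
              if_false, add_zero, mul_one, eq_comm (a := c q)]
            ring
          · intro x _ hxq
            simp [hxq.symm, hq]
          · exact fun h => absurd (Finset.mem_erase.2 ⟨hq, hqI⟩) h
        · rw [Finset.sum_eq_zero]
          · simp only [colorVec, hqI, false_and, and_false, if_false, add_zero]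
          · intro x hx
            have : q ≠ x := fun h => hqI (h ▸ Finset.mem_of_mem_erase hx)
            simp [this, hq]
    · by_cases hq : q = u
      · subst hq
        by_cases hpI : p ∈ Finset.Icc 1 n
        · rw [Finset.sum_eq_single p]
          · simp only [colorVec, Function.update_self, Function.update_of_ne hp, hu, hpI,
              true_and, Pi.single_apply, Prod.mk.injEq, hp, false_and, if_true,
              if_false, zero_add, mul_one]
            ring
          · intro x _ hxq
            simp [hxq.symm, hp]
          · exact fun h => absurd (Finset.mem_erase.2 ⟨hp, hpI⟩) h
        · rw [Finset.sum_eq_zero]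
          · simp only [colorVec, hpI, false_and, if_false, add_zero]
          · intro x hx
            have : p ≠ x := fun h => hpI (h ▸ Finset.mem_of_mem_erase hx)
            simp [this, hp]
      · rw [Finset.sum_eq_zero]
        · simp [colorVec, hp, hq]
        · intro x _
          simp [hp, hq]
  · rw [Prod.snd_add, Prod.snd_sum, Pi.add_apply, Finset.sum_apply]
    simp only [Prod.smul_snd, edgeVec, smul_zero, Pi.zero_apply, Finset.sum_const_zero, add_zero]
    simp only [colorVec]
    refine if_congr (and_congr_right fun _ => and_congr_right fun hy => ?_) rfl rfl
    by_cases hyu : y = u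
    · subst hyu
      constructor
      · intro h
        have := h w hw (by simp [hwu.ne, hcw])
        omega
      · intro h
        have := h v hv hcv
        omega
    · constructor
      · intro h x hx hxy
        by_cases hxu : x = u
        · subst hxu
          have := h v hv (by simp [hvu.ne, hyu, hcv, hxy])
          omega
        · exact h x hx (by simp [hxu, hyu, hxy])
      · intro h x hx hxy
        by_cases hxu : x = u
        · subst hxu
          have := h w hw (by simpa [hyu, hcw] using hxy)
          omega
        · exact h x hx (by simpa [hxu, hyu] using hxy)

/-- A partition lies on the face `x_{a,3} + x_3 = 1` iff `3` is joined to `a` or is joined to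
neither of `1`, `2`. -/
def IsTight (a : ℕ) (c : ℕ → ℕ) : Prop :=
  c a = c 3 ∨ (c 1 ≠ c 3 ∧ c 2 ≠ c 3)

lemma Icc_one_eq_insert {n : ℕ} (hn : 3 ≤ n) :
    Finset.Icc 1 n = insert 1 (insert 2 (insert 3 (Finset.Icc 4 n))) := by
  ext v
  simp only [Finset.mem_insert, Finset.mem_Icc]
  omega

open Classical in
/-- The number of colour classes, counted by their smallest elements. -/
lemma card_eq_sum_min {n K : ℕ} {c : ℕ → ℕ} (hc : IsKColoring n K c) :
    (K : ℝ) = ∑ v ∈ Finset.Icc 1 n,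
      if IsRep n c v then (1 : ℝ) else 0 := by
  classical
  rw [Finset.sum_boole, ← hc]
  congr 1
  symm
  apply Finset.card_nbij c
  · intro v hv
    exact Finset.mem_image_of_mem _ (Finset.mem_filter.1 hv).1
  · intro v hv w hw h
    simp only [Finset.coe_filter, Set.mem_ofPred_eq] at hv hw
    exact le_antisymm (hv.2 w hw.1 h.symm) (hw.2 v hv.1 h)
  · intro k hk
    obtain ⟨x, hx, hxk⟩ := Finset.mem_image.1 (Finset.mem_coe.1 hk)
    have hne : ((Finset.Icc 1 n).filter (fun v => c v = k)).Nonempty :=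
      ⟨x, Finset.mem_filter.2 ⟨hx, hxk⟩⟩
    have hm := Finset.mem_filter.1 (Finset.min'_mem _ hne)
    refine ⟨_, ?_, hm.2⟩
    simp only [Finset.coe_filter, Set.mem_ofPred_eq]
    refine ⟨hm.1, fun w hw h => Finset.min'_le _ _ ?_⟩
    exact Finset.mem_filter.2 ⟨hw, h.trans hm.2⟩

/-- The linear form of the inequality. -/
def rep3Form (n a : ℕ) : GPoint →ₗ[ℝ] ℝ where
  toFun x := x.1 (1, 2) + x.1 (a, 3) - ∑ i ∈ Finset.Icc 4 n, x.2 i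
  map_add' x y := by
    simp only [Prod.fst_add, Prod.snd_add, Pi.add_apply, Finset.sum_add_distrib]
    ring
  map_smul' r x := by
    simp only [Prod.smul_fst, Prod.smul_snd, Pi.smul_apply, smul_eq_mul, ← Finset.mul_sum,
      RingHom.id_apply]
    ring

open Classical in
lemma rep3Form_colorVec {n K a : ℕ} {c : ℕ → ℕ} (hn : 3 ≤ n) (ha : a = 1 ∨ a = 2)
    (hc : IsKColoring n K c) :
    rep3Form n a (colorVec n c) = if IsTight a c then 3 - (K : ℝ) else 2 - K := by
  have h1 : 1 ∈ Finset.Icc 1 n := Finset.mem_Icc.2 ⟨by omega, by omega⟩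
  have h2 : 2 ∈ Finset.Icc 1 n := Finset.mem_Icc.2 ⟨by omega, by omega⟩
  have h3 : 3 ∈ Finset.Icc 1 n := Finset.mem_Icc.2 ⟨by omega, by omega⟩
  have hK := card_eq_sum_min hc
  have hs : ∀ f : ℕ → ℝ, ∑ v ∈ Finset.Icc 1 n, f v =
      f 1 + (f 2 + (f 3 + ∑ v ∈ Finset.Icc 4 n, f v)) := fun f => by
    rw [Icc_one_eq_insert hn, Finset.sum_insert (by simp), Finset.sum_insert (by simp),
      Finset.sum_insert (by simp)]
  rw [hs] at hK
  have hsum : ∑ i ∈ Finset.Icc 4 n, (colorVec n c).2 i = ∑ v ∈ Finset.Icc 4 n,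
      if IsRep n c v then (1 : ℝ) else 0 := by
    refine Finset.sum_congr rfl fun v hv => ?_
    have := Finset.mem_Icc.1 hv
    simp only [colorVec]
    refine if_congr ⟨fun h => h.2.2, fun h => ⟨this.1, Finset.mem_Icc.2 ⟨by omega, this.2⟩, h⟩⟩
      rfl rfl
  have r1 : IsRep n c 1 := fun w hw _ => (Finset.mem_Icc.1 hw).1
  have r2 : IsRep n c 2 ↔ c 1 ≠ c 2 := by
    constructor
    · intro h h'
      have := h 1 h1 h'
      omega
    · intro h w hw h'
      have := (Finset.mem_Icc.1 hw).1
      by_contra hlt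
      obtain rfl : w = 1 := by omega
      exact h h'
  have r3 : IsRep n c 3 ↔ c 1 ≠ c 3 ∧ c 2 ≠ c 3 := by
    constructor
    · intro h
      exact ⟨fun h' => absurd (h 1 h1 h') (by omega), fun h' => absurd (h 2 h2 h') (by omega)⟩
    · intro h w hw h'
      have := (Finset.mem_Icc.1 hw).1
      by_contra hlt
      obtain rfl | rfl : w = 1 ∨ w = 2 := by omega
      exacts [h.1 h', h.2 h']
  rw [if_pos r1, if_congr r2 rfl rfl, if_congr r3 rfl rfl] at hK
  change (colorVec n c).1 (1, 2) + (colorVec n c).1 (a, 3) -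
    ∑ i ∈ Finset.Icc 4 n, (colorVec n c).2 i = _
  rw [hsum]
  have haI : a ∈ Finset.Icc 1 n := by rcases ha with rfl | rfl <;> assumption
  simp only [colorVec, h1, h2, h3, haI, true_and, IsTight]
  rcases ha with rfl | rfl <;> by_cases e1 : c 1 = c 2 <;> by_cases e2 : c 1 = c 3 <;>
    by_cases e3 : c 2 = c 3 <;> simp_all <;> linarith

/-- The colouring keeping the elements of `S` apart and putting everything else with `1`. -/
def sepColor (S : Finset ℕ) (v : ℕ) : ℕ := if v ∈ S then v else 1

lemma isKColoring_sepColor {n : ℕ} {S : Finset ℕ} (hS : S ⊆ Finset.Icc 1 n) (h1 : 1 ∈ S) :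
    IsKColoring n S.card (sepColor S) := by
  rw [IsKColoring]
  congr 1
  ext k
  simp only [Finset.mem_image, sepColor]
  constructor
  · rintro ⟨v, _, rfl⟩
    split_ifs <;> assumption
  · exact fun hk => ⟨k, hS hk, if_pos hk⟩

lemma exists_separated {n K : ℕ} {A B : Finset ℕ} (hA : A ⊆ Finset.Icc 1 n)
    (hAB : Disjoint A B) (hAK : A.card ≤ K) (hK : K + B.card ≤ n) :
    ∃ S ⊆ Finset.Icc 1 n, A ⊆ S ∧ Disjoint S B ∧ S.card = K := by
  have hsub : A ⊆ Finset.Icc 1 n \ B := fun x hx =>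
    Finset.mem_sdiff.2 ⟨hA hx, Finset.disjoint_left.1 hAB hx⟩
  have hcard : K ≤ (Finset.Icc 1 n \ B).card := by
    have := Finset.le_card_sdiff B (Finset.Icc 1 n)
    rw [Nat.card_Icc] at this
    omega
  obtain ⟨S, h1, h2, h3⟩ := Finset.exists_subsuperset_card_eq hsub hAK hcard
  exact ⟨S, h2.trans Finset.sdiff_subset, h1,
    Finset.disjoint_left.2 fun x hx => (Finset.mem_sdiff.1 (h2 hx)).2, h3⟩

section Functional

variable {n K a : ℕ} {L : GPoint →ₗ[ℝ] ℝ} {l : ℝ}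

lemma map_colorVec_update {c : ℕ → ℕ} {u k v w : ℕ} (hu : u ∈ Finset.Icc 1 n)
    (hv : v ∈ Finset.Icc 1 n) (hvu : v < u) (hcv : c v = c u)
    (hw : w ∈ Finset.Icc 1 n) (hwu : w < u) (hcw : c w = k) :
    L (colorVec n (Function.update c u k)) =
      L (colorVec n c) + ∑ x ∈ (Finset.Icc 1 n).erase u,
      ((if c x = k then (1 : ℝ) else 0) - (if c x = c u then 1 else 0)) * L (edgeVec u x) := by
  rw [colorVec_update hu hv hvu hcv hw hwu hcw, map_add, map_sum]
  simp

/-- Moving a vertex `u ≥ 4` between the classes of two smaller vertices, inside the face. -/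
lemma sum_eq_zero_of_tight (hL : ∀ c, IsKColoring n K c → IsTight a c → L (colorVec n c) = l)
    (ha : a = 1 ∨ a = 2) {c : ℕ → ℕ} (hc : IsKColoring n K c) (ht : IsTight a c) {u v w : ℕ}
    (hu : u ∈ Finset.Icc 4 n) (hv : v ∈ Finset.Icc 1 3) (hcv : c v = c u)
    (hw : w ∈ Finset.Icc 1 3) :
    ∑ x ∈ (Finset.Icc 1 n).erase u,
      ((if c x = c w then (1 : ℝ) else 0) - (if c x = c u then 1 else 0)) * L (edgeVec u x) = 0 := by
  rw [Finset.mem_Icc] at hu hv hw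
  have hu' : u ∈ Finset.Icc 1 n := Finset.mem_Icc.2 (by omega)
  have hv' : v ∈ Finset.Icc 1 n := Finset.mem_Icc.2 (by omega)
  have hw' : w ∈ Finset.Icc 1 n := Finset.mem_Icc.2 (by omega)
  have h := map_colorVec_update (L := L) hu' hv' (by omega) hcv hw' (by omega) rfl
  have ht' : IsTight a (Function.update c u (c w)) := by
    have hau : a ≠ u := by omega
    have h1 : 1 ≠ u := by omega
    have h2 : 2 ≠ u := by omega
    have h3 : 3 ≠ u := by omega
    simpa [IsTight, Function.update_of_ne, hau, h1, h2, h3] using ht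
  rw [hL c hc ht,
    hL _ (hc.update hv' (by omega) hcv hw' (by omega) rfl) ht'] at h
  linarith

lemma map_edgeVec_eq_zero_of_four_le
    (hL : ∀ c, IsKColoring n K c → IsTight a c → L (colorVec n c) = l)
    (ha : a = 1 ∨ a = 2) (hn : 5 ≤ n) (hK1 : 3 ≤ K) (hK2 : K + 2 ≤ n)
    {u w : ℕ} (hu : u ∈ Finset.Icc 4 n) (hw : w ∈ Finset.Icc 4 n) (huw : u ≠ w) :
    L (edgeVec u w) = 0 := by
  have hu' := Finset.mem_Icc.1 hu
  have hw' := Finset.mem_Icc.1 hw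
  obtain ⟨S, hS, hA, hB, rfl⟩ := exists_separated (n := n) (K := K) (A := {1, 2, 3}) (B := {u, w})
    (by intro x; simp only [Finset.mem_insert, Finset.mem_singleton, Finset.mem_Icc]; omega)
    (by
      rw [Finset.disjoint_left]; intro x
      simp only [Finset.mem_insert, Finset.mem_singleton]; omega)
    (by simpa using hK1) (by rw [Finset.card_pair huw]; exact hK2)
  have h1 : 1 ∈ S := hA (by simp)
  have h2 : 2 ∈ S := hA (by simp)
  have h3 : 3 ∈ S := hA (by simp)
  have huS : u ∉ S := fun h => Finset.disjoint_left.1 hB h (by simp)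
  have hwS : w ∉ S := fun h => Finset.disjoint_left.1 hB h (by simp)
  have hc := isKColoring_sepColor hS h1
  have c1 : sepColor S 1 = 1 := if_pos h1
  have c2 : sepColor S 2 = 2 := if_pos h2
  have c3 : sepColor S 3 = 3 := if_pos h3
  have cu : sepColor S u = 1 := if_neg huS
  have cw : sepColor S w = 1 := if_neg hwS
  have ht : IsTight a (sepColor S) := Or.inr (by simp [c1, c2, c3])
  have hwI : w ∈ Finset.Icc 1 n := Finset.mem_Icc.2 (by omega)
  have hc' : IsKColoring n S.card (Function.update (sepColor S) w 2) :=
    hc.update (v := 1) (w := 2) (Finset.mem_Icc.2 (by omega)) (by omega) (by rw [c1, cw])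
      (Finset.mem_Icc.2 (by omega)) (by omega) c2
  have w1 : 1 ≠ w := by omega
  have w2 : 2 ≠ w := by omega
  have w3 : 3 ≠ w := by omega
  have ht' : IsTight a (Function.update (sepColor S) w 2) :=
    Or.inr (by simp [w1, w2, w3, c1, c2, c3])
  have e1 := sum_eq_zero_of_tight hL ha hc ht hu (v := 1) (w := 2) (by simp) (by rw [c1, cu])
    (by simp)
  have e2 := sum_eq_zero_of_tight hL ha hc' ht' hu (v := 1) (w := 2) (by simp)
    (by simp [w1, huw, c1, cu]) (by simp)
  have hwe : w ∈ (Finset.Icc 1 n).erase u := Finset.mem_erase.2 ⟨huw.symm, hwI⟩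
  rw [← Finset.add_sum_erase _ _ hwe] at e1 e2
  have heq : ∀ x ∈ ((Finset.Icc 1 n).erase u).erase w,
      Function.update (sepColor S) w 2 x = sepColor S x := fun x hx =>
    Function.update_of_ne (Finset.ne_of_mem_erase hx) _ _
  rw [Finset.sum_congr rfl (fun x hx => by rw [heq x hx])] at e2
  simp only [Function.update_of_ne w2, Function.update_of_ne huw, Function.update_self, c2, cu,
    cw] at e1 e2
  norm_num at e1 e2
  linarith

lemma map_edgeVec_three_eq_zero
    (hL : ∀ c, IsKColoring n K c → IsTight a c → L (colorVec n c) = l)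
    (ha : a = 1 ∨ a = 2) (hn : 5 ≤ n) (hK1 : 3 ≤ K) (hK2 : K + 2 ≤ n)
    {u : ℕ} (hu : u ∈ Finset.Icc 4 n) : L (edgeVec u 3) = 0 := by
  have hu' := Finset.mem_Icc.1 hu
  have hsum : ∀ f : ℕ → ℝ, ∑ x ∈ (Finset.Icc 1 n).erase u, f x * L (edgeVec u x) =
      f 1 * L (edgeVec u 1) + f 2 * L (edgeVec u 2) + f 3 * L (edgeVec u 3) := by
    intro f
    have hsub : ({1, 2, 3} : Finset ℕ) ⊆ (Finset.Icc 1 n).erase u := by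
      intro x
      simp only [Finset.mem_insert, Finset.mem_singleton, Finset.mem_erase, Finset.mem_Icc]
      omega
    rw [← Finset.sum_subset hsub]
    · rw [Finset.sum_insert (by simp), Finset.sum_insert (by simp), Finset.sum_singleton, add_assoc]
    · intro x hx hx'
      simp only [Finset.mem_insert, Finset.mem_singleton, Finset.mem_erase, Finset.mem_Icc]
        at hx hx'
      rw [map_edgeVec_eq_zero_of_four_le hL ha hn hK1 hK2 hu (Finset.mem_Icc.2 (by omega))
        (by omega), mul_zero]
  have hc3 : ∀ w ∈ Finset.Icc 1 3, L (edgeVec u w) = L (edgeVec u 1) := by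
    obtain ⟨S, hS, hA, hB, rfl⟩ := exists_separated (n := n) (K := K) (A := {1, 2, 3}) (B := {u})
      (by intro x; simp only [Finset.mem_insert, Finset.mem_singleton, Finset.mem_Icc]; omega)
      (by
        rw [Finset.disjoint_left]; intro x
        simp only [Finset.mem_insert, Finset.mem_singleton]; omega)
      (by simpa using hK1) (by rw [Finset.card_singleton]; omega)
    have h1 : 1 ∈ S := hA (by simp)
    have c1 : sepColor S 1 = 1 := if_pos h1
    have c2 : sepColor S 2 = 2 := if_pos (hA (by simp))
    have c3 : sepColor S 3 = 3 := if_pos (hA (by simp))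
    have cu : sepColor S u = 1 := if_neg fun h => Finset.disjoint_left.1 hB h (by simp)
    intro w hw
    have e := sum_eq_zero_of_tight hL ha (isKColoring_sepColor hS h1)
      (Or.inr (by simp [c1, c2, c3])) hu (v := 1) (by simp) (by rw [c1, cu]) hw
    rw [hsum, c1, c2, c3, cu] at e
    rw [Finset.mem_Icc] at hw
    obtain rfl | rfl | rfl : w = 1 ∨ w = 2 ∨ w = 3 := by omega
    · rfl
    · rw [c2] at e; norm_num at e; linarith
    · rw [c3] at e; norm_num at e; linarith
  obtain ⟨S, hS, hA, hB, rfl⟩ := exists_separated (n := n) (K := K) (A := {1, 3}) (B := {2, u})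
    (by intro x; simp only [Finset.mem_insert, Finset.mem_singleton, Finset.mem_Icc]; omega)
    (by
      rw [Finset.disjoint_left]; intro x
      simp only [Finset.mem_insert, Finset.mem_singleton]; omega)
    (by rw [Finset.card_pair (by omega)]; omega) (by rw [Finset.card_pair (by omega)]; omega)
  have h1 : 1 ∈ S := hA (by simp)
  have c1 : sepColor S 1 = 1 := if_pos h1
  have c2 : sepColor S 2 = 1 := if_neg fun h => Finset.disjoint_left.1 hB h (by simp)
  have c3 : sepColor S 3 = 3 := if_pos (hA (by simp))
  have cu : sepColor S u = 1 := if_neg fun h => Finset.disjoint_left.1 hB h (by simp)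
  have e := sum_eq_zero_of_tight hL ha (isKColoring_sepColor hS h1)
    (Or.inr (by simp [c1, c2, c3])) hu (v := 1) (w := 3) (by simp) (by rw [c1, cu]) (by simp)
  rw [hsum, c1, c2, c3, cu] at e
  have e2 := hc3 2 (by simp)
  have e3 := hc3 3 (by simp)
  norm_num at e
  linarith

/-- A functional constant on the tight vertices is constant on the remaining ones. -/
lemma map_colorVec_of_not_tight
    (hL : ∀ c, IsKColoring n K c → IsTight a c → L (colorVec n c) = l)
    (ha : a = 1 ∨ a = 2) (hn : 5 ≤ n) (hK1 : 3 ≤ K) (hK2 : K + 2 ≤ n)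
    {c : ℕ → ℕ} (hc : IsKColoring n K c) (ht : ¬ IsTight a c) :
    L (colorVec n c) = l - L (edgeVec 3 a) + L (edgeVec 3 (3 - a)) := by
  obtain ⟨b, hb, hab, hba⟩ : ∃ b, (b = 1 ∨ b = 2) ∧ b ≠ a ∧ 3 - a = b :=
    ⟨3 - a, by omega, by omega, rfl⟩
  rw [hba]
  have hca : c a ≠ c 3 := fun h => ht (Or.inl h)
  have hcb : c b = c 3 := by
    by_contra h
    refine ht (Or.inr ?_)
    rcases ha with rfl | rfl <;> rcases hb with rfl | rfl <;> simp_all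
  have haI : a ∈ Finset.Icc 1 n := Finset.mem_Icc.2 (by omega)
  have hbI : b ∈ Finset.Icc 1 n := Finset.mem_Icc.2 (by omega)
  have h := map_colorVec_update (L := L) (c := c) (u := 3) (Finset.mem_Icc.2 (by omega)) hbI
    (by omega) hcb haI (by omega) rfl
  have hsub : ({a, b} : Finset ℕ) ⊆ (Finset.Icc 1 n).erase 3 := by
    intro x
    simp only [Finset.mem_insert, Finset.mem_singleton, Finset.mem_erase, Finset.mem_Icc]
    omega
  have ha3 : a ≠ 3 := by omega
  rw [hL _ (hc.update hbI (by omega) hcb haI (by omega) rfl)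
      (Or.inl (by rw [Function.update_self, Function.update_of_ne ha3])),
    ← Finset.sum_subset hsub, Finset.sum_pair hab.symm, hcb] at h
  · simp only [if_true, hca, hca.symm, if_false] at h
    linarith
  · intro x hx hx'
    simp only [Finset.mem_insert, Finset.mem_singleton, Finset.mem_erase, Finset.mem_Icc]
      at hx hx'
    rw [edgeVec_comm, map_edgeVec_three_eq_zero hL ha hn hK1 hK2 (Finset.mem_Icc.2 (by omega)),
      mul_zero]

end Functional

lemma exists_tight {n K : ℕ} (a : ℕ) (hK1 : 3 ≤ K) (hK2 : K ≤ n) :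
    ∃ c, IsKColoring n K c ∧ IsTight a c := by
  obtain ⟨S, hS, hA, -, rfl⟩ := exists_separated (n := n) (K := K) (A := {1, 2, 3}) (B := ∅)
    (by intro x; simp only [Finset.mem_insert, Finset.mem_singleton, Finset.mem_Icc]; omega)
    (by simp) (by simpa using hK1) (by simpa using hK2)
  refine ⟨sepColor S, isKColoring_sepColor hS (hA (by simp)), Or.inr ?_⟩
  have h : ∀ x ∈ ({1, 2, 3} : Finset ℕ), sepColor S x = x := fun x hx => if_pos (hA hx)
  rw [h 1 (by simp), h 2 (by simp), h 3 (by simp)]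
  omega

lemma exists_not_tight {n K a : ℕ} (ha : a = 1 ∨ a = 2) (hK1 : 3 ≤ K) (hK2 : K + 1 ≤ n) :
    ∃ c, IsKColoring n K c ∧ ¬ IsTight a c := by
  obtain ⟨S, hS, hA, hB, rfl⟩ := exists_separated (n := n) (K := K) (A := {1, 2}) (B := {3})
    (by intro x; simp only [Finset.mem_insert, Finset.mem_singleton, Finset.mem_Icc]; omega)
    (by simp) (by rw [Finset.card_pair (by omega)]; omega) (by simpa using hK2)
  have c1 : sepColor S 1 = 1 := if_pos (hA (by simp))
  have c2 : sepColor S 2 = 2 := if_pos (hA (by simp))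
  have c3 : sepColor S 3 = 1 := if_neg fun h => Finset.disjoint_left.1 hB h (by simp)
  have hc := isKColoring_sepColor hS (hA (by simp))
  rcases ha with rfl | rfl
  · refine ⟨Function.update (sepColor S) 3 2, hc.update (v := 1) (w := 2)
      (Finset.mem_Icc.2 (by omega)) (by omega) (by rw [c1, c3])
      (Finset.mem_Icc.2 (by omega)) (by omega) c2, ?_⟩
    simp [IsTight, c1, c2]
  · exact ⟨_, hc, by simp [IsTight, c1, c2, c3]⟩

/-- If a linear form takes exactly the values `b` and `b' ≠ b` on the generators of a polytope,
and every functional constant on the generators of value `b` is constant on those of value `b'`,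
then the face of value `b` has codimension one. -/
lemma adim_face_add_one {V : Set GPoint} (hV : V.Finite) (φ : GPoint →ₗ[ℝ] ℝ) {b b' : ℝ}
    (hbb : b ≠ b') (hφ : ∀ x ∈ V, φ x = b ∨ φ x = b')
    (hb : ∃ x ∈ V, φ x = b) (hb' : ∃ x ∈ V, φ x = b')
    (hconst : ∀ (L : GPoint →ₗ[ℝ] ℝ) (l : ℝ), (∀ x ∈ V, φ x = b → L x = l) →
      ∃ l', ∀ x ∈ V, φ x = b' → L x = l') :
    adim {x | x ∈ convexHull ℝ V ∧ φ x = b} + 1 = adim (convexHull ℝ V) := by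
  set F := {x | x ∈ convexHull ℝ V ∧ φ x = b}
  rw [adim, adim, affineSpan_convexHull, direction_affineSpan, direction_affineSpan]
  set D := vectorSpan ℝ F with hD
  set W := vectorSpan ℝ V with hW
  have hDW : D ≤ W := by
    have h : W = vectorSpan ℝ (convexHull ℝ V) := by
      rw [hW, ← direction_affineSpan, ← direction_affineSpan, affineSpan_convexHull]
    rw [h]
    exact vectorSpan_mono ℝ fun x hx => hx.1
  have hfin : FiniteDimensional ℝ W := finiteDimensional_vectorSpan_of_finite ℝ hV
  obtain ⟨p, hp, hpb⟩ := hb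
  obtain ⟨q, hq, hqb⟩ := hb'
  have hDφ : ∀ x ∈ D, φ x = 0 := by
    intro x hx
    have : D ≤ LinearMap.ker φ := by
      rw [hD, vectorSpan_def, Submodule.span_le]
      rintro _ ⟨y, hy, z, hz, rfl⟩
      simp [hy.2, hz.2]
    exact this hx
  have hWD : ∀ x ∈ W, φ x = 0 → x ∈ D := by
    intro x hx hx0
    by_contra hxD
    obtain ⟨L, hLx, hLD⟩ := Submodule.exists_dual_map_eq_bot_of_notMem hxD inferInstance
    have hLD' : ∀ y ∈ D, L y = 0 := fun y hy => by
      have : L y ∈ D.map L := Submodule.mem_map_of_mem hy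
      rwa [hLD, Submodule.mem_bot] at this
    have hLb : ∀ y ∈ V, φ y = b → L y = L p := by
      intro y hy hyb
      have : y - p ∈ D := vsub_mem_vectorSpan ℝ (⟨subset_convexHull ℝ V hy, hyb⟩ : y ∈ F)
        (⟨subset_convexHull ℝ V hp, hpb⟩ : p ∈ F)
      have := hLD' _ this
      rw [map_sub] at this
      linarith
    obtain ⟨l', hl'⟩ := hconst L (L p) hLb
    set M : GPoint →ₗ[ℝ] ℝ := (b - b') • L - (L p - l') • φ with hM
    have hMV : ∀ y ∈ V, M y = (b - b') * L p - (L p - l') * b := by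
      intro y hy
      simp only [hM, LinearMap.sub_apply, LinearMap.smul_apply, smul_eq_mul]
      rcases hφ y hy with h | h
      · rw [h, hLb y hy h]
      · rw [h, hl' y hy h]; ring
    have hMW : W ≤ LinearMap.ker M := by
      rw [hW, vectorSpan_def, Submodule.span_le]
      rintro _ ⟨y, hy, z, hz, rfl⟩
      simp [hMV y hy, hMV z hz]
    have hMx : M x = 0 := hMW hx
    simp only [hM, LinearMap.sub_apply, LinearMap.smul_apply, smul_eq_mul, hx0, mul_zero,
      sub_zero] at hMx
    exact (mul_ne_zero (sub_ne_zero.2 hbb) hLx) hMx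
  have hrank := LinearMap.finrank_range_add_finrank_ker (φ.domRestrict W)
  have hrange : LinearMap.range (φ.domRestrict W) = ⊤ := by
    refine LinearMap.range_eq_top.2 (LinearMap.surjective fun h => ?_)
    have := LinearMap.congr_fun h ⟨p - q, vsub_mem_vectorSpan ℝ hp hq⟩
    simp only [LinearMap.domRestrict_apply, map_sub, hpb, hqb, LinearMap.zero_apply] at this
    exact hbb (sub_eq_zero.1 this)
  have hker : LinearMap.ker (φ.domRestrict W) = D.comap W.subtype := by
    ext x
    simp only [LinearMap.mem_ker, LinearMap.domRestrict_apply, Submodule.mem_comap,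
      Submodule.subtype_apply]
    exact ⟨hWD x x.2, hDφ x⟩
  rw [hrange, finrank_top, Module.finrank_self, hker,
    (Submodule.comapSubtypeEquivOfLe hDW).finrank_eq] at hrank
  rw [add_comm]
  exact hrank

/-- For `n ≥ 5`, `3 ≤ K ≤ n-2` and `a ∈ {1,2}`, the inequality
`x_{1,2} + x_{a,3} - Σ_{i=4}^n x_i ≤ 3 - K` (expressing `x_{a,3} + x_3 ≤ 1`) is
facet-defining for `P_{n,K}`. -/
theorem upper_rep3_facet (n K a : ℕ) (hn : 5 ≤ n) (hK1 : 3 ≤ K) (hK2 : K ≤ n - 2)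
    (ha : a = 1 ∨ a = 2) :
    IsFacetLe n K
      (fun x => x.1 (1, 2) + x.1 (a, 3) - ∑ i ∈ Finset.Icc 4 n, x.2 i)
      ((3 : ℝ) - (K : ℝ)) := by
  classical
  have hKn : K + 2 ≤ n := by omega
  have hval := fun c (hc : IsKColoring n K c) => rep3Form_colorVec (by omega : 3 ≤ n) ha hc
  have htight : ∀ c, IsKColoring n K c → (rep3Form n a (colorVec n c) = 3 - (K : ℝ) ↔
      IsTight a c) := by
    intro c hc
    rw [hval c hc]
    split_ifs with h
    · simp [h]
    · simp [h]
  refine ⟨?_, ?_⟩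
  · have : PolyP n K ⊆ {x | rep3Form n a x ≤ 3 - (K : ℝ)} := by
      refine convexHull_min ?_ (convex_halfSpace_le (rep3Form n a).isLinear _)
      rw [setOf_charVec_eq]
      rintro _ ⟨c, hc, rfl⟩
      rw [Set.mem_ofPred_eq, hval c hc]
      split_ifs <;> linarith
    exact fun x hx => this hx
  · refine adim_face_add_one (finite_setOf_charVec n K) (rep3Form n a) (b' := 2 - (K : ℝ))
      (fun h => by linarith) ?_ ?_ ?_ ?_
    all_goals rw [setOf_charVec_eq]
    · rintro _ ⟨c, hc, rfl⟩
      rw [hval c hc]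
      split_ifs <;> simp
    · obtain ⟨c, hc, ht⟩ := exists_tight (n := n) a hK1 (by omega)
      exact ⟨_, ⟨c, hc, rfl⟩, (htight c hc).2 ht⟩
    · obtain ⟨c, hc, ht⟩ := exists_not_tight (n := n) ha hK1 (by omega)
      exact ⟨_, ⟨c, hc, rfl⟩, by rw [hval c hc, if_neg ht]⟩
    · intro L l hL
      have hL' : ∀ c, IsKColoring n K c → IsTight a c → L (colorVec n c) = l :=
        fun c hc ht => hL _ ⟨c, hc, rfl⟩ ((htight c hc).2 ht)
      refine ⟨l - L (edgeVec 3 a) + L (edgeVec 3 (3 - a)), ?_⟩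
      rintro _ ⟨c, hc, rfl⟩ h
      refine map_colorVec_of_not_tight hL' ha hn hK1 hKn hc fun ht => ?_
      have := (htight c hc).2 ht
      linarith
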